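/- arXiv:2103.11333 — 4 statements merged into one kernel-verified Lean document; each statement's English description precedes it below -/
import Mathlib

section
/- Let n ≥ 1 and let f_1, …, f_n : ℝ^d → ℝ be differentiable convex functions whose gradients are L-Lipschitz (‖∇f_i(x) − ∇f_i(y)‖ ≤ L‖x − y‖ for all x, y) for some L > 0, and let f = (1/n)∑_{i=1}^n f_i. Then for all x, w ∈ ℝ^d, (1/n)·∑_{i=1}^n ‖∇f_i(x) − ∇f_i(w) + ∇f(w) − ∇f(x)‖² ≤ 2L·( f(w) − f(x) − ⟨∇f(x), w − x⟩ ). -/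
open scoped RealInnerProductSpace

section Smooth

variable {E : Type*} [NormedAddCommGroup E] [InnerProductSpace ℝ E] [CompleteSpace E]

theorem hasDerivAt_comp_line {f : E → ℝ} (hf : Differentiable ℝ f) (x v : E) (t : ℝ) :
    HasDerivAt (fun s : ℝ => f (x + s • v)) ⟪gradient f (x + t • v), v⟫ t := by
  have hline : HasDerivAt (fun s : ℝ => x + s • v) v t := by
    simpa using ((hasDerivAt_id t).smul_const v).const_add x
  rw [inner_gradient_left]
  exact (hf (x + t • v)).hasFDerivAt.comp_hasDerivAt t hline

theorem ConvexOn.add_inner_gradient_le {f : E → ℝ} (hf : Differentiable ℝ f)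
    (hconv : ConvexOn ℝ Set.univ f) (x y : E) :
    f x + ⟪gradient f x, y - x⟫ ≤ f y := by
  have hline : ConvexOn ℝ Set.univ (fun s : ℝ => f (x + s • (y - x))) := by
    have h := hconv.comp_affineMap (AffineMap.lineMap (k := ℝ) x y)
    simpa [Function.comp_def, AffineMap.lineMap_apply, add_comm] using h
  have h := hline.le_slope_of_hasDerivAt (Set.mem_univ 0) (Set.mem_univ 1) zero_lt_one
    (hasDerivAt_comp_line hf x (y - x) 0)
  simp only [slope_def_field, zero_smul, one_smul, add_zero, add_sub_cancel, sub_zero,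
    div_one] at h
  linarith

/-- The descent lemma for functions with Lipschitz gradient. -/
theorem le_add_inner_gradient_add_sq {f : E → ℝ} {L : ℝ} (hf : Differentiable ℝ f)
    (hlip : ∀ x y, ‖gradient f x - gradient f y‖ ≤ L * ‖x - y‖) (x y : E) :
    f y ≤ f x + ⟪gradient f x, y - x⟫ + L / 2 * ‖y - x‖ ^ 2 := by
  set v := y - x with hv
  have hderiv (t : ℝ) : HasDerivAt
      (fun s : ℝ => f (x + s • v) - s * ⟪gradient f x, v⟫ - s ^ 2 * (L / 2 * ‖v‖ ^ 2))
      (⟪gradient f (x + t • v), v⟫ - ⟪gradient f x, v⟫ - t * (L * ‖v‖ ^ 2)) t := by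
    refine (((hasDerivAt_comp_line hf x v t).sub
      ((hasDerivAt_id t).mul_const ⟪gradient f x, v⟫)).sub
      ((hasDerivAt_pow 2 t).mul_const (L / 2 * ‖v‖ ^ 2))).congr_deriv ?_
    norm_num
    ring
  have hanti := antitoneOn_of_deriv_nonpos (convex_Icc (0 : ℝ) 1)
    (fun t _ => (hderiv t).continuousAt.continuousWithinAt)
    (fun t _ => (hderiv t).differentiableAt.differentiableWithinAt) (by
      intro t ht
      rw [interior_Icc] at ht
      rw [(hderiv t).deriv, ← inner_sub_left, sub_nonpos]
      calc ⟪gradient f (x + t • v) - gradient f x, v⟫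
          ≤ ‖gradient f (x + t • v) - gradient f x‖ * ‖v‖ := real_inner_le_norm _ _
        _ ≤ L * ‖x + t • v - x‖ * ‖v‖ := by gcongr; exact hlip _ _
        _ = t * (L * ‖v‖ ^ 2) := by
          rw [add_sub_cancel_left, norm_smul, Real.norm_of_nonneg ht.1.le]
          ring)
  have h := hanti (Set.left_mem_Icc.2 zero_le_one) (Set.right_mem_Icc.2 zero_le_one) zero_le_one
  simp only [one_smul, zero_smul, hv, add_sub_cancel, add_zero] at h
  linarith

theorem ConvexOn.norm_gradient_sub_sq_le {f : E → ℝ} {L : ℝ} (hL : 0 < L)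
    (hf : Differentiable ℝ f) (hconv : ConvexOn ℝ Set.univ f)
    (hlip : ∀ x y, ‖gradient f x - gradient f y‖ ≤ L * ‖x - y‖) (x w : E) :
    ‖gradient f x - gradient f w‖ ^ 2 ≤ 2 * L * (f w - f x - ⟪gradient f x, w - x⟫) := by
  set g := gradient f x - gradient f w with hg
  have hlower := hconv.add_inner_gradient_le hf x (w + L⁻¹ • g)
  have hupper := le_add_inner_gradient_add_sq hf hlip w (w + L⁻¹ • g)
  rw [add_sub_cancel_left, norm_smul, mul_pow, Real.norm_of_nonneg (inv_nonneg.2 hL.le),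
    inner_smul_right] at hupper
  rw [add_sub_right_comm, inner_add_right, inner_smul_right] at hlower
  have hinner : ⟪gradient f x, g⟫ - ⟪gradient f w, g⟫ = ‖g‖ ^ 2 := by
    rw [← inner_sub_left, ← hg, real_inner_self_eq_norm_sq]
  have hscale : L / 2 * (L⁻¹ ^ 2 * ‖g‖ ^ 2) = L⁻¹ * ‖g‖ ^ 2 / 2 := by
    field_simp
  have hbound : L⁻¹ * ‖g‖ ^ 2 ≤ 2 * (f w - f x - ⟪gradient f x, w - x⟫) := by
    have := congrArg (L⁻¹ * ·) hinner
    simp only [mul_sub] at this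
    linarith
  rw [inv_mul_le_iff₀ hL] at hbound
  linarith

theorem gradient_const_mul_sum {ι : Type*} [Fintype ι] {f : ι → E → ℝ}
    (hf : ∀ i, Differentiable ℝ (f i)) (c : ℝ) (x : E) :
    gradient (fun y => c * ∑ i, f i y) x = c • ∑ i, gradient (f i) x := by
  apply HasGradientAt.gradient
  rw [hasGradientAt_iff_hasFDerivAt]
  simpa [map_sum] using
    (HasFDerivAt.fun_sum fun i (_ : i ∈ Finset.univ) => (hf i x).hasFDerivAt).const_mul c

end Smooth

theorem sum_norm_sub_mean_sq_le {E ι : Type*} [NormedAddCommGroup E] [InnerProductSpace ℝ E]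
    [Fintype ι] [Nonempty ι] (a : ι → E) :
    ∑ i, ‖a i - (1 / (Fintype.card ι : ℝ)) • ∑ j, a j‖ ^ 2 ≤ ∑ i, ‖a i‖ ^ 2 := by
  set m := (1 / (Fintype.card ι : ℝ)) • ∑ j, a j with hm
  have hsum : ∑ j, a j = (Fintype.card ι : ℝ) • m := by
    rw [hm, smul_smul, mul_one_div_cancel (by simp), one_smul]
  simp only [norm_sub_sq_real, Finset.sum_add_distrib, Finset.sum_sub_distrib, ← Finset.mul_sum,
    ← sum_inner, hsum, inner_smul_left, real_inner_self_eq_norm_sq, Finset.sum_const,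
    Finset.card_univ, nsmul_eq_mul, conj_trivial]
  have : 0 ≤ (Fintype.card ι : ℝ) * ‖m‖ ^ 2 := by positivity
  linarith

/-- Variance bound (39) for the SVRG gradient estimator:
`(1/n) ∑ᵢ ‖∇fᵢ(x) − ∇fᵢ(w) + ∇f(w) − ∇f(x)‖² ≤ 2L (f(w) − f(x) − ⟨∇f(x), w − x⟩)`. -/
theorem svrg_variance_bregman_bound {d n : ℕ} (hn : 1 ≤ n)
    (f : Fin n → EuclideanSpace ℝ (Fin d) → ℝ) (L : ℝ) (hL : 0 < L)
    (hdiff : ∀ i, Differentiable ℝ (f i))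
    (hconv : ∀ i, ConvexOn ℝ Set.univ (f i))
    (hlip : ∀ i x y, ‖gradient (f i) x - gradient (f i) y‖ ≤ L * ‖x - y‖)
    (F : EuclideanSpace ℝ (Fin d) → ℝ)
    (hF : F = fun x => (1 / (n : ℝ)) * ∑ i, f i x) :
    ∀ x w, (1 / (n : ℝ)) *
        ∑ i, ‖gradient (f i) x - gradient (f i) w + gradient F w - gradient F x‖ ^ 2 ≤
      2 * L * (F w - F x - ⟪gradient F x, w - x⟫) := by
  intro x w
  have : Nonempty (Fin n) := ⟨⟨0, hn⟩⟩
  have hgrad (z : EuclideanSpace ℝ (Fin d)) :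
      gradient F z = (1 / (n : ℝ)) • ∑ i, gradient (f i) z := by
    rw [hF, gradient_const_mul_sum hdiff]
  calc (1 / (n : ℝ)) *
        ∑ i, ‖gradient (f i) x - gradient (f i) w + gradient F w - gradient F x‖ ^ 2
      ≤ (1 / (n : ℝ)) * ∑ i, ‖gradient (f i) x - gradient (f i) w‖ ^ 2 := by
        gcongr ?_ * ?_
        refine le_of_eq_of_le (Finset.sum_congr rfl fun i _ => ?_)
          (sum_norm_sub_mean_sq_le fun i => gradient (f i) x - gradient (f i) w)
        rw [hgrad, hgrad, Finset.sum_sub_distrib, smul_sub, Fintype.card_fin]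
        congr 2
        abel
    _ ≤ (1 / (n : ℝ)) *
        ∑ i, 2 * L * (f i w - f i x - ⟪gradient (f i) x, w - x⟫) := by
        gcongr with i
        exact (hconv i).norm_gradient_sub_sq_le hL (hdiff i) (hlip i) x w
    _ = 2 * L * (F w - F x - ⟪gradient F x, w - x⟫) := by
        rw [hgrad, hF, inner_smul_left, sum_inner]
        simp only [← Finset.mul_sum, Finset.sum_sub_distrib, conj_trivial]
        ring
end

section
/- Let x, u, x⋆, g ∈ ℝ^d and let μ ≥ 0, η > 0, α > 0, θ > 0. Define x⁺ = (1/(1 + μη))·(x + μη·u) − (η/α)·g. Then ⟨g, θ·(x⁺ − x⋆)⟩ ≤ (αθ/((1 + μη)·η))·( (1/2)‖x − x⋆‖² − ((1 + μη)/2)‖x⁺ − x⋆‖² + (μη/2)‖u − x⋆‖² − (1/2)‖x − x⁺‖² ). -/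
open scoped RealInnerProductSpace

/-- Polarization identity for three points of a real inner product space. -/
theorem inner_sub_sub_eq_norm_sq {E : Type*} [NormedAddCommGroup E] [InnerProductSpace ℝ E]
    (a b c : E) :
    ⟪a - b, b - c⟫ = (‖a - c‖ ^ 2 - ‖a - b‖ ^ 2 - ‖b - c‖ ^ 2) / 2 := by
  have h := norm_add_sq_real (a - b) (b - c)
  rw [sub_add_sub_cancel] at h
  linarith

/-- Three-point inequality for the ANITA gradient update
`x⁺ = (x + μη u)/(1 + μη) − (η/α) g`. -/
theorem anita_three_point_inequality {d : ℕ}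
    (x u xstar g : EuclideanSpace ℝ (Fin d)) (μ η α θ : ℝ)
    (hμ : 0 ≤ μ) (hη : 0 < η) (hα : 0 < α) (hθ : 0 < θ)
    (xplus : EuclideanSpace ℝ (Fin d))
    (hxplus : xplus = (1 / (1 + μ * η)) • (x + (μ * η) • u) - (η / α) • g) :
    ⟪g, θ • (xplus - xstar)⟫ ≤
      (α * θ / ((1 + μ * η) * η)) *
        ((1 / 2) * ‖x - xstar‖ ^ 2
          - ((1 + μ * η) / 2) * ‖xplus - xstar‖ ^ 2
          + (μ * η / 2) * ‖u - xstar‖ ^ 2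
          - (1 / 2) * ‖x - xplus‖ ^ 2) := by
  have hk : 0 < 1 + μ * η := by positivity
  have hg : g = (α / ((1 + μ * η) * η)) • ((x - xplus) + (μ * η) • (u - xplus)) := by
    rw [hxplus]
    match_scalars <;> field_simp <;> ring
  have hinner : ⟪g, θ • (xplus - xstar)⟫ = (α * θ / ((1 + μ * η) * η)) *
      (⟪x - xplus, xplus - xstar⟫ + μ * η * ⟪u - xplus, xplus - xstar⟫) := by
    conv_lhs => rw [hg]
    simp only [inner_smul_left, inner_smul_right, inner_add_left, conj_trivial]
    ring
  rw [hinner]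
  refine mul_le_mul_of_nonneg_left ?_ (by positivity)
  have hx := inner_sub_sub_eq_norm_sq x xplus xstar
  have hu := inner_sub_sub_eq_norm_sq u xplus xstar
  have hm : 0 ≤ μ * η * ‖u - xplus‖ ^ 2 := by positivity
  rw [hx, hu]
  linarith
end

section
/- Let n be a positive integer and for each integer s ≥ 1 define p(s) = max{ 4/(s + 3√n), 4/(n + 3) } and θ(s) = 2/( p(s)·(s + 3√n) ). Then for every integer s ≥ 2, (1 − p(s)·θ(s)) / ( p(s)·θ(s)² ) ≤ 1 / ( p(s−1)·θ(s−1)² ). -/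
/-- Monotonicity (45) of the dynamic ANITA parameters: with
`p(s) = max{4/(s + 3√n), 4/(n + 3)}` and `θ(s) = 2/(p(s)(s + 3√n))`, for all `s ≥ 2`
one has `(1 − p(s)θ(s))/(p(s)θ(s)²) ≤ 1/(p(s−1)θ(s−1)²)`. -/
theorem anita_dynamic_parameter_monotonicity (n : ℕ) (hn : 0 < n) (p θ : ℕ → ℝ)
    (hp : ∀ s, p s = max (4 / ((s : ℝ) + 3 * Real.sqrt n)) (4 / ((n : ℝ) + 3)))
    (hθ : ∀ s, θ s = 2 / (p s * ((s : ℝ) + 3 * Real.sqrt n))) :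
    ∀ s : ℕ, 2 ≤ s →
      (1 - p s * θ s) / (p s * θ s ^ 2) ≤ 1 / (p (s - 1) * θ (s - 1) ^ 2) := by
  intro s hs
  obtain ⟨m, rfl⟩ : ∃ m, s = m + 1 := ⟨s - 1, by omega⟩
  have hm : (1 : ℝ) ≤ m := by exact_mod_cast Nat.le_of_succ_le_succ hs
  rw [Nat.add_sub_cancel, hθ, hθ]
  have hpos : ∀ k, 0 < p k := fun k => by
    rw [hp]
    exact lt_max_of_lt_right (by positivity)
  have hmono : p (m + 1) ≤ p m := by
    rw [hp, hp]
    push_cast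
    gcongr
    linarith
  have h₀ := hpos m
  have h₁ := hpos (m + 1)
  have hr := Real.sqrt_nonneg (n : ℝ)
  push_cast
  generalize p (m + 1) = a at *
  generalize p m = b at *
  obtain ⟨v, hv⟩ : ∃ v, v = (m : ℝ) + 3 * Real.sqrt n := ⟨_, rfl⟩
  have hv1 : 1 ≤ v := by linarith
  rw [add_right_comm, ← hv]
  calc (1 - a * (2 / (a * (v + 1)))) / (a * (2 / (a * (v + 1))) ^ 2)
      = a * (v ^ 2 - 1) / 4 := by
        field_simp
        ring
    _ ≤ b * v ^ 2 / 4 := by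
        have : 0 ≤ v ^ 2 - 1 := by nlinarith
        gcongr
        linarith
    _ = 1 / (b * (2 / (b * v)) ^ 2) := by
        field_simp
        norm_num
end

section
/- Let L > 0, μ > 0, and p ∈ (0, 1]. Set θ = (1/2)·min{ 1, √(μ/(pL)) } and η = (1 − θ)/( L·θ·(2 − θ) ) (equivalently η = 1/( Lθ(1 + 1/(1 − θ)) )). Then 1/(1 + μη) ≤ 1 − (4pθ)/5. -/
/-- Contraction factor comparison (62) for ANITA in the strongly convex case:
with `θ = (1/2) min{1, √(μ/(pL))}` and `η = (1 − θ)/(Lθ(2 − θ))`,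
one has `1/(1 + μη) ≤ 1 − 4pθ/5`. -/
theorem anita_contraction_factor (L μ p : ℝ) (hL : 0 < L) (hμ : 0 < μ)
    (hp : p ∈ Set.Ioc (0 : ℝ) 1) (θ η : ℝ)
    (hθ : θ = (1 / 2) * min 1 (Real.sqrt (μ / (p * L))))
    (hη : η = (1 - θ) / (L * θ * (2 - θ))) :
    1 / (1 + μ * η) ≤ 1 - 4 * p * θ / 5 := by
  obtain ⟨hp0, hp1⟩ := hp
  have hpL : 0 < p * L := mul_pos hp0 hL
  have hθ0 : 0 < θ := by rw [hθ]; positivity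
  have hθ1 : θ ≤ 1 / 2 := by
    linarith [min_le_left 1 (Real.sqrt (μ / (p * L)))]
  have hθsq : (2 * θ) ^ 2 ≤ μ / (p * L) := by
    rw [← Real.le_sqrt (by positivity) (by positivity)]
    linarith [min_le_right 1 (Real.sqrt (μ / (p * L)))]
  have hμθ : 4 * p * L * θ ^ 2 ≤ μ := by
    rw [le_div_iff₀ hpL] at hθsq
    linarith
  have hy0 : 0 < p * θ := mul_pos hp0 hθ0
  have hy1 : p * θ ≤ 1 / 2 := by nlinarith
  have hη_lower : 4 * (p * θ) / 3 ≤ μ * η := by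
    have hden : 0 < L * θ * (2 - θ) := mul_pos (mul_pos hL hθ0) (by linarith)
    rw [hη, ← mul_div_assoc, le_div_iff₀ hden]
    calc 4 * (p * θ) / 3 * (L * θ * (2 - θ))
        = 4 * p * L * θ ^ 2 * ((2 - θ) / 3) := by ring
      _ ≤ 4 * p * L * θ ^ 2 * (1 - θ) := by gcongr; linarith
      _ ≤ μ * (1 - θ) := by gcongr; linarith
  rw [div_le_iff₀ (by linarith)]
  calc 1 ≤ (1 - 4 * p * θ / 5) * (1 + 4 * (p * θ) / 3) := by nlinarith
    _ ≤ (1 - 4 * p * θ / 5) * (1 + μ * η) := by gcongr; linarith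
end
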